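/- Let a and b be positive integers and let (A_1,B_1),...,(A_m,B_m) be a skew Bollobás system with |A_i| ≤ a and |B_i| ≤ b for every i ∈ {1,...,m}. Then |A_1 ∪ A_2 ∪ ... ∪ A_m| ≤ C(a+b+1, a) − 1, where C denotes the binomial coefficient. -/

import Mathlib

/-- A skew Bollobás system: pairs `(A i, B i)` of finite sets with `A i ∩ B i = ∅`
and `A i ∩ B j ≠ ∅` whenever `i < j`. -/
def IsSkewBollobasSystem (m : ℕ) (A B : Fin m → Finset ℕ) : Prop :=
  (∀ i, Disjoint (A i) (B i)) ∧ (∀ i j : Fin m, i < j → (A i ∩ B j).Nonempty)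

open Finset Polynomial

/-- A product of `n` vectors from the span of a family lies in the span of the degree `n` monomials
in that family. -/
theorem multiset_prod_mem_span_sym {R S κ : Type*} [CommSemiring R] [CommSemiring S] [Algebra R S]
    (W : κ → S) (T : Multiset S) (hT : ∀ f ∈ T, f ∈ Submodule.span R (Set.range W)) :
    T.prod ∈ Submodule.span R
      (Set.range fun s : Sym κ (Multiset.card T) ↦ ((s : Multiset κ).map W).prod) := by
  induction T using Multiset.induction_on with
  | empty => exact Submodule.subset_span ⟨⟨0, rfl⟩, by change ((0 : Multiset κ).map W).prod = _; simp⟩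
  | cons f T ih =>
    rw [Multiset.prod_cons]
    have h := Submodule.mul_mem_mul (hT f (Multiset.mem_cons_self f T))
      (ih fun g hg ↦ hT g (Multiset.mem_cons_of_mem hg))
    rw [Submodule.span_mul_span] at h
    refine Submodule.span_mono ?_ h
    rintro _ ⟨_, ⟨k, rfl⟩, _, ⟨s, rfl⟩, rfl⟩
    exact ⟨⟨k ::ₘ s, by simp⟩, by simp⟩

/-- If the `j`-th member of a finite family of functions is nonzero at `j` and vanishes at smaller
indices, and all members are products of `n` vectors in the span of `W`, then the family is no larger than
the number of degree `n` monomials in `W`. -/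
theorem card_le_of_triangular {ι κ : Type*} [Fintype ι] [LinearOrder ι] [Fintype κ]
    (n : ℕ) (W : κ → ι → ℚ) (T : ι → Multiset (ι → ℚ)) (hn : ∀ j, Multiset.card (T j) = n)
    (hT : ∀ j, ∀ f ∈ T j, f ∈ Submodule.span ℚ (Set.range W))
    (hdiag : ∀ i, (T i).prod i ≠ 0) (hupper : ∀ i j, i < j → (T j).prod i = 0) :
    Fintype.card ι ≤ (Fintype.card κ).multichoose n := by
  classical
  have hind : LinearIndependent ℚ fun j ↦ (T j).prod := by
    refine Matrix.linearIndependent_rows_of_det_ne_zero (A := Matrix.of fun j ↦ (T j).prod) ?_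
    rw [Matrix.det_of_isUpperTriangular (M := Matrix.of fun j ↦ (T j).prod) fun j i h ↦ hupper i j h]
    exact prod_ne_zero_iff.2 fun i _ ↦ hdiag i
  have hmem : Set.range (fun j ↦ (T j).prod) ≤ (Submodule.span ℚ
      (Set.range fun s : Sym κ n ↦ ((s : Multiset κ).map W).prod) : Set (ι → ℚ)) := by
    rintro _ ⟨j, rfl⟩
    have h := multiset_prod_mem_span_sym (R := ℚ) W (T j) (hT j)
    rwa [hn j] at h
  have h := linearIndependent_le_span_aux' _ hind _ hmem
  refine h.trans ?_
  rw [← Sym.card_sym_eq_multichoose]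
  exact Fintype.card_range_le _

/-- The skew Bollobás theorem: a skew Bollobás system with `|A i| ≤ a` and `|B i| ≤ b` has at most
`(a + b).choose b` pairs. -/
theorem card_le_choose_of_skew {ι : Type*} [Fintype ι] [LinearOrder ι] (a b : ℕ)
    (A B : ι → Finset ℕ) (hdisj : ∀ i, Disjoint (A i) (B i))
    (hinter : ∀ i j, i < j → (A i ∩ B j).Nonempty)
    (hA : ∀ i, #(A i) ≤ a) (hB : ∀ i, #(B i) ≤ b) :
    Fintype.card ι ≤ (a + b).choose b := by
  let p : ι → ℚ[X] := fun i ↦ (∏ x ∈ A i, (X - C (x : ℚ))) * (X + C 1) ^ (a - #(A i))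
  have hmon : ∀ i, (p i).Monic := fun i ↦
    (monic_prod_of_monic _ _ fun x _ ↦ monic_X_sub_C _).mul ((monic_X_add_C 1).pow _)
  have hdeg : ∀ i, (p i).natDegree = a := fun i ↦ by
    rw [Monic.natDegree_mul (monic_prod_of_monic _ _ fun x _ ↦ monic_X_sub_C _)
      ((monic_X_add_C 1).pow _), natDegree_prod_of_monic _ _ fun x _ ↦ monic_X_sub_C _,
      (monic_X_add_C 1).natDegree_pow]
    simp only [natDegree_X_sub_C, natDegree_X_add_C, sum_const, smul_eq_mul, mul_one]
    exact Nat.add_sub_cancel' (hA i)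
  have heval : ∀ i (x : ℕ), (p i).eval (x : ℚ) = 0 ↔ x ∈ A i := fun i x ↦ by
    have hx : (x : ℚ) + 1 ≠ 0 := by positivity
    simp [p, eval_prod, prod_eq_zero_iff, sub_eq_zero, hx]
  let W : Fin (a + 1) → ι → ℚ := fun k i ↦ (p i).coeff k
  let L : ℕ → ι → ℚ := fun x i ↦ (p i).eval (x : ℚ)
  have hL : ∀ x, L x ∈ Submodule.span ℚ (Set.range W) := fun x ↦ by
    have h : L x = ∑ k : Fin (a + 1), ((x : ℚ) ^ (k : ℕ)) • W k := by
      ext i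
      simp only [L, W, Finset.sum_apply, Pi.smul_apply, smul_eq_mul]
      rw [eval_eq_sum_range, hdeg, ← Fin.sum_univ_eq_sum_range
        (fun k ↦ (p i).coeff k * (x : ℚ) ^ k)]
      exact sum_congr rfl fun k _ ↦ mul_comm _ _
    rw [h]
    exact Submodule.sum_mem _ fun k _ ↦ Submodule.smul_mem _ _ (Submodule.subset_span ⟨k, rfl⟩)
  have hone : (1 : ι → ℚ) ∈ Submodule.span ℚ (Set.range W) := by
    refine Submodule.subset_span ⟨Fin.last a, ?_⟩
    ext i
    have h := (hmon i).coeff_natDegree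
    rw [hdeg] at h
    simpa [W] using h
  let T : ι → Multiset (ι → ℚ) := fun j ↦
    (B j).val.map L + Multiset.replicate (b - #(B j)) 1
  have hprod : ∀ i j, (T j).prod i = ∏ x ∈ B j, (p i).eval (x : ℚ) := fun i j ↦ by
    have h : (T j).prod = ∏ x ∈ B j, L x := by simp [T]
    rw [h, prod_apply]
  have h := card_le_of_triangular b W T (fun j ↦ by simp [T, hB j]) ?_ ?_ ?_
  · rw [Fintype.card_fin, Nat.multichoose_eq] at h
    rwa [show a + 1 + b - 1 = a + b by lia] at h
  · intro j f hf
    rcases Multiset.mem_add.1 hf with hf | hf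
    · obtain ⟨x, -, rfl⟩ := Multiset.mem_map.1 hf
      exact hL x
    · rwa [Multiset.eq_of_mem_replicate hf]
  · intro i
    rw [hprod, prod_ne_zero_iff]
    exact fun x hx h ↦ disjoint_left.1 (hdisj i) ((heval i x).1 h) hx
  · intro i j hij
    obtain ⟨x, hx⟩ := hinter i j hij
    rw [mem_inter] at hx
    rw [hprod]
    exact prod_eq_zero hx.2 ((heval i x).2 hx.1)

/-- The elements of `A i` that belong to no other `A j` with `j ∈ I`. -/
def privateElements {ι α : Type*} [DecidableEq ι] [DecidableEq α] (A : ι → Finset α)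
    (I : Finset ι) (i : ι) : Finset α :=
  A i \ (I.erase i).biUnion A

theorem mem_privateElements {ι α : Type*} [DecidableEq ι] [DecidableEq α] {A : ι → Finset α}
    {I : Finset ι} {i : ι} {x : α} :
    x ∈ privateElements A I i ↔ x ∈ A i ∧ ∀ j ∈ I, x ∈ A j → j = i := by
  simp only [privateElements, mem_sdiff, mem_biUnion, mem_erase]
  grind

theorem privateElements_subset {ι α : Type*} [DecidableEq ι] [DecidableEq α] (A : ι → Finset α)
    (I : Finset ι) (i : ι) : privateElements A I i ⊆ A i :=
  sdiff_subset

theorem card_biUnion_le_card_biUnion_erase_add {ι α : Type*} [DecidableEq ι] [DecidableEq α]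
    (A : ι → Finset α) {I : Finset ι} {i : ι} (hi : i ∈ I) :
    #(I.biUnion A) ≤ #((I.erase i).biUnion A) + #(privateElements A I i) := by
  rw [← insert_erase hi, biUnion_insert, insert_erase hi, union_comm, ← union_sdiff_self_eq_union]
  exact card_union_le _ _

/-- In a skew Bollobás system every `A i` of which has at least `s + 1` private elements, these can
be merged into a single one, which improves the bound of the skew Bollobás theorem. -/
theorem card_le_choose_of_privateElements {ι : Type*} [LinearOrder ι] (c s b : ℕ)
    (A B : ι → Finset ℕ) (I : Finset ι) (hdisj : ∀ i ∈ I, Disjoint (A i) (B i))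
    (hinter : ∀ i ∈ I, ∀ j ∈ I, i < j → (A i ∩ B j).Nonempty)
    (hA : ∀ i ∈ I, #(A i) ≤ c + s) (hB : ∀ i ∈ I, #(B i) ≤ b)
    (hP : ∀ i ∈ I, s + 1 ≤ #(privateElements A I i)) :
    #I ≤ (c + b).choose b := by
  classical
  have hne : ∀ i : I, ∃ x, x ∈ privateElements A I i := fun i ↦
    card_pos.1 (by have := hP i i.2; lia)
  choose r hr using hne
  have huniq : ∀ (i j : I) x, x ∈ privateElements A I i → x ∈ A j → j = i := fun i j x hi hj ↦
    Subtype.ext ((mem_privateElements.1 hi).2 j j.2 hj)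
  let g : ℕ → ℕ := fun x ↦
    if h : ∃ i : I, x ∈ privateElements A I i then r h.choose else x
  have hg : ∀ (i : I) x, x ∈ privateElements A I i → g x = r i := fun i x hx ↦ by
    have h : ∃ i : I, x ∈ privateElements A I i := ⟨i, hx⟩
    have hi : i = h.choose := huniq _ _ x h.choose_spec (privateElements_subset A I i hx)
    simp only [g, dif_pos h, ← hi]
  have hg' : ∀ x, (¬ ∃ i : I, x ∈ privateElements A I i) → g x = x := fun x hx ↦ dif_neg hx
  have h := card_le_choose_of_skew c b (fun i : I ↦ (A i).image g) (fun i : I ↦ (B i).image g)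
    ?_ ?_ ?_ fun i ↦ card_image_le.trans (hB i i.2)
  · simpa using h
  · intro j
    rw [disjoint_left]
    intro y hyA hyB
    obtain ⟨x, hx, rfl⟩ := mem_image.1 hyA
    obtain ⟨z, hz, hzx⟩ := mem_image.1 hyB
    have hxz : x ∈ A j → z ∈ A j → False := fun _ ↦ fun hzA ↦
      disjoint_left.1 (hdisj j j.2) hzA hz
    by_cases hzp : ∃ k : I, z ∈ privateElements A I k
    · obtain ⟨k, hk⟩ := hzp
      rw [hg k z hk] at hzx
      have hxk : r k ∈ A j → False := fun hrj ↦ by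
        have := huniq k j _ (hr k) hrj
        subst this
        exact hxz hx (privateElements_subset _ _ _ hk)
      by_cases hxp : ∃ l : I, x ∈ privateElements A I l
      · obtain ⟨l, hl⟩ := hxp
        rw [hg l x hl, ← huniq l j x hl hx] at hzx
        exact hxk (hzx ▸ privateElements_subset _ _ _ (hr j))
      · rw [hg' x hxp] at hzx
        exact hxk (hzx ▸ hx)
    · rw [hg' z hzp] at hzx
      by_cases hxp : ∃ l : I, x ∈ privateElements A I l
      · obtain ⟨l, hl⟩ := hxp
        rw [hg l x hl] at hzx
        exact hzp ⟨l, hzx ▸ hr l⟩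
      · rw [hg' x hxp] at hzx
        exact hxz hx (hzx ▸ hx)
  · intro i j hij
    obtain ⟨x, hx⟩ := hinter i i.2 j j.2 hij
    rw [mem_inter] at hx
    exact ⟨g x, mem_inter.2 ⟨mem_image_of_mem g hx.1, mem_image_of_mem g hx.2⟩⟩
  · intro i
    have hsub : (A i).image g ⊆ insert (r i) ((A i \ privateElements A I i).image g) := by
      intro y hy
      obtain ⟨x, hx, rfl⟩ := mem_image.1 hy
      by_cases hxp : x ∈ privateElements A I i
      · exact mem_insert.2 (Or.inl (hg i x hxp))
      · exact mem_insert_of_mem (mem_image_of_mem g (mem_sdiff.2 ⟨hx, hxp⟩))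
    have h1 := (card_le_card hsub).trans (card_insert_le _ _)
    have h2 : #((A i \ privateElements A I i).image g) ≤ _ := card_image_le
    have h3 := card_sdiff_add_card_eq_card (privateElements_subset A I i)
    have h4 := hA i i.2
    have h5 := hP i i.2
    lia

theorem card_biUnion_le_mul_card_add_sum {ι : Type*} [LinearOrder ι] (b : ℕ)
    (A B : ι → Finset ℕ) (hdisj : ∀ i, Disjoint (A i) (B i))
    (hinter : ∀ i j, i < j → (A i ∩ B j).Nonempty) (hB : ∀ i, #(B i) ≤ b) (t s : ℕ)
    (hA : ∀ i, #(A i) ≤ t + s) (I : Finset ι) :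
    #(I.biUnion A) ≤ s * #I + ∑ k ∈ range t, (k + 1 + b).choose b := by
  induction t generalizing s I with
  | zero =>
    have := card_biUnion_le_card_mul I A s fun i _ ↦ by simpa using hA i
    simpa [mul_comm] using this
  | succ t ih =>
    induction I using Finset.strongInduction with
    | H I ihI =>
      by_cases hP : ∀ i ∈ I, s + 1 ≤ #(privateElements A I i)
      · have h1 := card_le_choose_of_privateElements (t + 1) s b A B I (fun i _ ↦ hdisj i)
          (fun i _ j _ ↦ hinter i j) (fun i _ ↦ hA i) (fun i _ ↦ hB i) hP
        have h2 := ih (s + 1) (fun i ↦ (hA i).trans (by lia)) I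
        rw [sum_range_succ]
        rw [add_mul, one_mul] at h2
        lia
      · push Not at hP
        obtain ⟨i, hi, hPi⟩ := hP
        have h1 := card_biUnion_le_card_biUnion_erase_add A hi
        have h2 := ihI _ (erase_ssubset hi)
        have h3 := card_erase_add_one hi
        rw [← h3, mul_add, mul_one]
        lia

theorem sum_range_choose_add_one (a b : ℕ) :
    ∑ k ∈ range a, (k + 1 + b).choose b + 1 = (a + b + 1).choose a := by
  induction a with
  | zero => simp
  | succ a ih =>
    rw [sum_range_succ, add_right_comm, ih, show a + 1 + b + 1 = (a + b + 1) + 1 by lia,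
      Nat.choose_succ_succ, add_right_inj, show a + 1 + b = a + b + 1 by lia]
    exact Nat.choose_symm_of_eq_add (by lia)

/-- Upper bound: for positive `a, b`, any skew Bollobás system with `|A i| ≤ a`, `|B i| ≤ b`
satisfies `|A 1 ∪ ⋯ ∪ A m| ≤ C(a+b+1, a) - 1`. -/
theorem union_A_card_le (a b m : ℕ) (ha : 0 < a) (hb : 0 < b)
    (A B : Fin m → Finset ℕ) (hsys : IsSkewBollobasSystem m A B)
    (hA : ∀ i, (A i).card ≤ a) (hB : ∀ i, (B i).card ≤ b) :
    (Finset.univ.biUnion A).card ≤ (a + b + 1).choose a - 1 := by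
  have h := card_biUnion_le_mul_card_add_sum b A B hsys.1 hsys.2 hB a 0 hA Finset.univ
  have h' := sum_range_choose_add_one a b
  lia
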